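/- arXiv:1611.02993 — 2 statements merged into one kernel-verified Lean document; each statement's English description precedes it below -/
import Mathlib

section
/- Let A : D(A) ⊆ H₀ → H₁ be a densely defined closed linear operator between Hilbert spaces with adjoint A*. The embedding of D(cA) := D(A) ∩ N(A)^⊥, equipped with the graph norm of A, into H₀ is compact if and only if the embedding of D(cA*) := D(A*) ∩ N(A*)^⊥, equipped with the graph norm of A*, into H₁ is compact. -/
open Submodule LinearPMap RealInnerProductSpace

noncomputable section

/-- The range of a partially defined linear operator, as a submodule. -/
def pRan {E F : Type*} [AddCommGroup E] [Module ℝ E] [AddCommGroup F] [Module ℝ F]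
    (A : E →ₗ.[ℝ] F) : Submodule ℝ F :=
  LinearMap.range A.toFun

/-- The kernel of a partially defined linear operator, as a submodule of the ambient space. -/
def pKer {E F : Type*} [AddCommGroup E] [Module ℝ E] [AddCommGroup F] [Module ℝ F]
    (A : E →ₗ.[ℝ] F) : Submodule ℝ E :=
  (LinearMap.ker A.toFun).map A.domain.subtype

variable {H₀ H₁ : Type*}
  [NormedAddCommGroup H₀] [InnerProductSpace ℝ H₀] [CompleteSpace H₀]
  [NormedAddCommGroup H₁] [InnerProductSpace ℝ H₁] [CompleteSpace H₁]

theorem mem_pKer_iff {E F : Type*} [AddCommGroup E] [Module ℝ E] [AddCommGroup F] [Module ℝ F]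
    {A : E →ₗ.[ℝ] F} {x : E} : x ∈ pKer A ↔ ((x, 0) : E × F) ∈ A.graph := by
  simp only [pKer, Submodule.mem_map, LinearMap.mem_ker, LinearPMap.mem_graph_iff]
  exact ⟨fun ⟨y, h, e⟩ => ⟨y, e, h⟩, fun ⟨y, e, h⟩ => ⟨y, h, e⟩⟩

section ReducedOperator

variable {E F : Type*}
  [NormedAddCommGroup E] [InnerProductSpace ℝ E]
  [NormedAddCommGroup F] [InnerProductSpace ℝ F]

/-- The graph-norm unit ball of the domain of the reduced operator of `A`. -/
def reducedUnitBall (A : E →ₗ.[ℝ] F) : Set E :=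
  {x : E | ∃ hx : x ∈ A.domain, x ∈ (pKer A)ᗮ ∧ ‖x‖ ^ 2 + ‖A ⟨x, hx⟩‖ ^ 2 ≤ 1}

/-- The graph of the reduced operator `A` restricted to `N(A)ᗮ`. -/
def reducedGraph (A : E →ₗ.[ℝ] F) : Submodule ℝ (E × F) :=
  A.graph ⊓ (pKer A)ᗮ.comap (LinearMap.fst ℝ E F)

theorem mem_reducedUnitBall {A : E →ₗ.[ℝ] F} {x : E} :
    x ∈ reducedUnitBall A ↔ ∃ y, (x, y) ∈ reducedGraph A ∧ ‖x‖ ^ 2 + ‖y‖ ^ 2 ≤ 1 := by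
  constructor
  · rintro ⟨hx, hk, hn⟩
    exact ⟨A ⟨x, hx⟩, ⟨A.mem_graph ⟨x, hx⟩, hk⟩, hn⟩
  · rintro ⟨y, ⟨hg, hk⟩, hn⟩
    obtain ⟨⟨z, hz⟩, rfl, rfl⟩ := A.mem_graph_iff.1 hg
    exact ⟨hz, hk, hn⟩

theorem isClosed_reducedGraph {A : E →ₗ.[ℝ] F} (hA : A.IsClosed) :
    IsClosed (reducedGraph A : Set (E × F)) :=
  IsClosed.inter hA ((Submodule.isClosed_orthogonal _).preimage continuous_fst)

/-- The Friedrichs–Poincaré estimate for an operator with compactly embedded reduced domain. -/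
theorem exists_norm_le_of_isCompact {A : E →ₗ.[ℝ] F} (hA : A.IsClosed)
    (hc : IsCompact (closure (reducedUnitBall A))) :
    ∃ c : ℝ, 0 < c ∧ ∀ p ∈ reducedGraph A, ‖p.1‖ ≤ c * ‖p.2‖ := by
  by_contra! H
  have key : ∀ n : ℕ, ∃ p ∈ reducedGraph A, ‖p.1‖ = 1 / 2 ∧ ‖p.2‖ ≤ 1 / ((n : ℝ) + 1 + 1) := by
    intro n
    obtain ⟨p, hp, hlt⟩ := H (n + 1 + 1) (by positivity)
    have hpos : 0 < ‖p.1‖ := lt_of_le_of_lt (by positivity) hlt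
    refine ⟨(1 / (2 * ‖p.1‖)) • p, (reducedGraph A).smul_mem _ hp, ?_, ?_⟩
    · rw [Prod.smul_fst, norm_smul, Real.norm_of_nonneg (by positivity)]
      field_simp
    · rw [Prod.smul_snd, norm_smul, Real.norm_of_nonneg (by positivity), div_mul_eq_mul_div,
        div_le_div_iff₀ (by positivity) (by positivity)]
      nlinarith
  choose p hp hp1 hp2 using key
  have hmem : ∀ n, (p n).1 ∈ closure (reducedUnitBall A) := by
    refine fun n => subset_closure (mem_reducedUnitBall.2 ⟨(p n).2, hp n, ?_⟩)
    have h2 : ‖(p n).2‖ ≤ 1 / 2 := (hp2 n).trans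
      (one_div_le_one_div_of_le two_pos (by linarith [(Nat.cast_nonneg n : (0 : ℝ) ≤ n)]))
    rw [hp1]
    nlinarith [norm_nonneg (p n).2]
  obtain ⟨x, -, φ, hφ, hx⟩ := hc.tendsto_subseq hmem
  have hy : Filter.Tendsto (fun n => (p n).2) Filter.atTop (nhds 0) := by
    refine squeeze_zero_norm hp2 ?_
    have := tendsto_one_div_add_atTop_nhds_zero_nat (𝕜 := ℝ)
    simpa [Function.comp_def] using this.comp (Filter.tendsto_add_atTop_nat 1)
  have hlim : ((x, 0) : E × F) ∈ reducedGraph A :=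
    (isClosed_reducedGraph hA).mem_of_tendsto
      (hx.prodMk_nhds (hy.comp hφ.tendsto_atTop)) (Filter.Eventually.of_forall fun n => hp (φ n))
  have hx0 : x = 0 := by
    have := hlim.2 x (mem_pKer_iff.2 hlim.1)
    simpa using this
  have hn : ‖x‖ = 1 / 2 := tendsto_nhds_unique hx.norm (by simp [hp1])
  simp [hx0] at hn

theorem isClosed_map_snd_reducedGraph [CompleteSpace E] [CompleteSpace F] {A : E →ₗ.[ℝ] F}
    (hA : A.IsClosed) {c : ℝ} (hc : 0 < c) (h : ∀ p ∈ reducedGraph A, ‖p.1‖ ≤ c * ‖p.2‖) :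
    IsClosed ((reducedGraph A).map (LinearMap.snd ℝ E F) : Set F) := by
  have : CompleteSpace (reducedGraph A) := (isClosed_reducedGraph hA).completeSpace_coe
  let f : reducedGraph A →L[ℝ] F :=
    (ContinuousLinearMap.snd ℝ E F).comp (reducedGraph A).subtypeL
  have hf : AntilipschitzWith (Real.toNNReal (c + 1)) f := by
    refine AddMonoidHomClass.antilipschitz_of_bound f fun p => ?_
    rw [Real.coe_toNNReal _ (by positivity)]
    have h1 := h p p.2
    have h2 := norm_nonneg (p : E × F).2
    refine (norm_prod_le_iff (x := (p : E × F))).2 ⟨?_, ?_⟩ <;>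
      change _ ≤ (c + 1) * ‖(p : E × F).2‖ <;> nlinarith
  convert hf.isClosed_range f.uniformContinuous using 1
  ext y
  simp [f]

/-- The kernel component can be removed from any element of the domain of a closed operator. -/
theorem exists_mem_reducedGraph [CompleteSpace E] {A : E →ₗ.[ℝ] F} (hA : A.IsClosed) {x : E} {y : F}
    (h : (x, y) ∈ A.graph) : ∃ x', (x', y) ∈ reducedGraph A := by
  have hcl : IsClosed (pKer A : Set E) := by
    have : (pKer A : Set E) = (fun x : E => ((x, 0) : E × F)) ⁻¹' (A.graph : Set (E × F)) := by
      ext x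
      exact mem_pKer_iff
    rw [this]
    exact IsClosed.preimage (by fun_prop) hA
  have : CompleteSpace (pKer A) := hcl.completeSpace_coe
  refine ⟨x - (pKer A).starProjection x, ?_, (pKer A).sub_starProjection_mem_orthogonal x⟩
  have := A.graph.sub_mem h (mem_pKer_iff.1 ((pKer A).starProjection_apply_mem x))
  simpa using this

/-- Compactness of the reduced embedding passes from a closed operator `A` to any formal adjoint
`B` whose kernel contains `R(A)ᗮ`. -/
theorem isCompact_closure_reducedUnitBall_of_isFormalAdjoint [CompleteSpace E] [CompleteSpace F]
    {A : E →ₗ.[ℝ] F} {B : F →ₗ.[ℝ] E} (hA : A.IsClosed) (hAB : A.IsFormalAdjoint B)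
    (hker : (pRan A)ᗮ ≤ pKer B) (hc : IsCompact (closure (reducedUnitBall A))) :
    IsCompact (closure (reducedUnitBall B)) := by
  obtain ⟨c, hc0, hle⟩ := exists_norm_le_of_isCompact hA hc
  have hcl := isClosed_map_snd_reducedGraph hA hc0 hle
  have hran : (pKer B)ᗮ ≤ (reducedGraph A).map (LinearMap.snd ℝ E F) := by
    have hsub : pRan A ≤ (reducedGraph A).map (LinearMap.snd ℝ E F) := by
      rintro _ ⟨x, rfl⟩
      obtain ⟨x', hx'⟩ := exists_mem_reducedGraph hA (A.mem_graph x)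
      exact ⟨_, hx', rfl⟩
    refine (Submodule.orthogonal_le hker).trans ?_
    rw [Submodule.orthogonal_orthogonal_eq_closure]
    exact Submodule.topologicalClosure_minimal _ hsub hcl
  have hinner : ∀ p ∈ A.graph, ∀ q ∈ B.graph, inner ℝ p.2 q.1 = inner ℝ p.1 q.2 := by
    rintro ⟨x, y⟩ hp ⟨z, w⟩ hq
    obtain ⟨x, rfl, rfl⟩ := A.mem_graph_iff.1 hp
    obtain ⟨z, rfl, rfl⟩ := B.mem_graph_iff.1 hq
    exact hAB x z
  set r : ℝ := 1 / (c + 1) with hr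
  have hr0 : 0 < r := by positivity
  let S : Set E := {x | x ∈ reducedUnitBall A ∧ ∃ q ∈ reducedGraph B,
    ‖q.1‖ ^ 2 + ‖q.2‖ ^ 2 ≤ 1 ∧ (x, r • q.1) ∈ A.graph}
  have hS : TotallyBounded S :=
    (hc.totallyBounded.subset subset_closure).subset fun x hx => hx.1
  have hlift : ∀ q ∈ reducedGraph B, ‖q.1‖ ^ 2 + ‖q.2‖ ^ 2 ≤ 1 →
      ∃ x ∈ S, (x, r • q.1) ∈ A.graph := by
    intro q hq hn
    obtain ⟨⟨x, y⟩, hp, hpq⟩ := hran hq.2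
    obtain rfl : y = q.1 := hpq
    have hg := (reducedGraph A).smul_mem r hp
    refine ⟨r • x, ⟨mem_reducedUnitBall.2 ⟨_, hg, ?_⟩, q, hq, hn, hg.1⟩, hg.1⟩
    have h1 : ‖x‖ ≤ c * ‖q.1‖ := hle _ hp
    have h2 : ‖q.1‖ ^ 2 ≤ 1 := by nlinarith [sq_nonneg ‖q.2‖]
    have h3 : ‖x‖ ^ 2 ≤ c ^ 2 * ‖q.1‖ ^ 2 := by
      rw [← mul_pow]
      gcongr
    change ‖r • x‖ ^ 2 + ‖r • q.1‖ ^ 2 ≤ 1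
    rw [norm_smul, norm_smul, Real.norm_of_nonneg hr0.le, mul_pow, mul_pow, ← mul_add, hr,
      div_pow, one_pow, div_mul_eq_mul_div, div_le_one (by positivity)]
    nlinarith [mul_le_mul_of_nonneg_left h2 (sq_nonneg c)]
  refine TotallyBounded.isCompact_of_isClosed (TotallyBounded.closure ?_) isClosed_closure
  rw [Metric.totallyBounded_iff]
  intro ε hε
  obtain ⟨t, htS, htf, hcov⟩ := Metric.finite_approx_of_totallyBounded hS (r * ε ^ 2 / 2)
    (by positivity)
  have hch : ∀ x : E, ∃ y : F, x ∈ S → ∃ w, (y, w) ∈ reducedGraph B ∧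
      ‖w‖ ≤ 1 ∧ (x, r • y) ∈ A.graph := by
    intro x
    by_cases hx : x ∈ S
    · obtain ⟨-, q, hq, hn, hg⟩ := hx
      exact ⟨q.1, fun _ => ⟨q.2, hq, by nlinarith [sq_nonneg ‖q.1‖], hg⟩⟩
    · exact ⟨0, fun h => absurd h hx⟩
  choose g hg using hch
  refine ⟨g '' t, htf.image g, fun y hy => ?_⟩
  obtain ⟨w, hyw, hn⟩ := mem_reducedUnitBall.1 hy
  have hw : ‖w‖ ≤ 1 := by nlinarith [sq_nonneg ‖y‖]
  obtain ⟨x, hxS, hx⟩ := hlift (y, w) hyw hn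
  obtain ⟨x', hx't, hdist⟩ := Set.mem_iUnion₂.1 (hcov hxS)
  obtain ⟨w', hyw', hw', hx'⟩ := hg x' (htS hx't)
  refine Set.mem_iUnion₂.2 ⟨g x', Set.mem_image_of_mem g hx't, ?_⟩
  rw [Metric.mem_ball, dist_eq_norm] at hdist ⊢
  have hkey := hinner _ (A.graph.sub_mem hx hx') _ (B.graph.sub_mem hyw.1 hyw'.1)
  simp only [Prod.mk_sub_mk, ← smul_sub, real_inner_smul_left, real_inner_self_eq_norm_sq] at hkey
  have hcs := real_inner_le_norm (x - x') (w - w')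
  have hww : ‖w - w'‖ ≤ 2 := (norm_sub_le _ _).trans (by linarith)
  have hlt : r * ‖y - g x'‖ ^ 2 < r * ε ^ 2 := by
    nlinarith [norm_nonneg (x - x')]
  exact lt_of_pow_lt_pow_left₀ 2 hε.le (lt_of_mul_lt_mul_left hlt hr0.le)

theorem orthogonal_pRan_le_pKer_adjoint [CompleteSpace E] {A : E →ₗ.[ℝ] F}
    (hdense : Dense (A.domain : Set E)) : (pRan A)ᗮ ≤ pKer (A†) := by
  intro y hy
  rw [mem_pKer_iff, adjoint_graph_eq_graph_adjoint hdense, Submodule.mem_adjoint_iff]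
  intro a b hab
  obtain ⟨x, -, rfl⟩ := A.mem_graph_iff.1 hab
  simpa using hy _ ⟨x, rfl⟩

theorem orthogonal_pRan_adjoint_le_pKer [CompleteSpace E] [CompleteSpace F] {A : E →ₗ.[ℝ] F}
    (hdense : Dense (A.domain : Set E)) (hA : A.IsClosed) : (pRan (A†))ᗮ ≤ pKer A := by
  intro x hx
  let G : Submodule ℝ (WithLp 2 (E × F)) :=
    A.graph.comap (WithLp.linearEquiv 2 ℝ (E × F)).toLinearMap
  have hG : IsClosed (G : Set (WithLp 2 (E × F))) :=
    IsClosed.preimage (WithLp.prod_continuous_ofLp 2 E F) hA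
  have hGG : Gᗮᗮ = G := by
    rw [Submodule.orthogonal_orthogonal_eq_closure, hG.submodule_topologicalClosure_eq]
  have hmem : WithLp.toLp 2 ((x, 0) : E × F) ∈ Gᗮᗮ := by
    intro u hu
    have hadj : (u.snd, -u.fst) ∈ A†.graph := by
      rw [adjoint_graph_eq_graph_adjoint hdense, Submodule.mem_adjoint_iff]
      intro a b hab
      have := hu (WithLp.toLp 2 (a, b)) hab
      simp only [WithLp.prod_inner_apply] at this
      simpa [add_comm] using this
    obtain ⟨z, -, hz⟩ := (A†).mem_graph_iff.1 hadj
    have := hx _ ⟨z, hz⟩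
    simpa [WithLp.prod_inner_apply] using this
  rw [hGG] at hmem
  exact mem_pKer_iff.2 hmem

end ReducedOperator

/-- The embedding of `D(cA) = D(A) ∩ N(A)^⊥` (graph norm of `A`) into `H₀` is
compact if and only if the embedding of `D(cA†) = D(A†) ∩ N(A†)^⊥` (graph norm of `A†`) into `H₁`
is compact, compactness of an embedding being expressed as relative compactness of the
corresponding graph-norm unit ball. -/
theorem statement4 (A : H₀ →ₗ.[ℝ] H₁) (hdense : Dense (A.domain : Set H₀))
    (hclosed : A.IsClosed) :
    IsCompact (closure {x : H₀ | ∃ hx : x ∈ A.domain,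
        x ∈ (pKer A)ᗮ ∧ ‖x‖ ^ 2 + ‖A ⟨x, hx⟩‖ ^ 2 ≤ 1}) ↔
      IsCompact (closure {y : H₁ | ∃ hy : y ∈ (A†).domain,
        y ∈ (pKer (A†))ᗮ ∧ ‖y‖ ^ 2 + ‖A† ⟨y, hy⟩‖ ^ 2 ≤ 1}) := by
  have h := adjoint_isFormalAdjoint hdense
  exact ⟨isCompact_closure_reducedUnitBall_of_isFormalAdjoint hclosed h.symm
      (orthogonal_pRan_le_pKer_adjoint hdense),
    isCompact_closure_reducedUnitBall_of_isFormalAdjoint (adjoint_isClosed hdense) h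
      (orthogonal_pRan_adjoint_le_pKer hdense hclosed)⟩
end
end

section
/- Let A₁ : D(A₁) ⊆ H₁ → H₂ and A₂ : D(A₂) ⊆ H₂ → H₃ be densely defined closed linear operators with R(A₁) ⊆ N(A₂) and with R(A₁) and R(A₂) closed. Let f ∈ H₃, g ∈ H₁, k ∈ H₂. Then the system A₂x = f, A₁*x = g, πx = k has a (necessarily unique) solution x ∈ D₂ := D(A₂) ∩ D(A₁*) if and only if f ∈ R(A₂), g ∈ R(A₁*), and k ∈ K₂. In that case the solution is x = x_f + x_g + k where x_f is the unique element of D(A₂) ∩ R(A₂*) with A₂x_f = f and x_g is the unique element of D(A₁*) ∩ R(A₁) with A₁*x_g = g; one has π_{R(A₂*)}x = x_f, π_{R(A₁)}x = x_g, πx = k, ‖x‖²_{H₂} = ‖x_f‖²_{H₂} + ‖x_g‖²_{H₂} + ‖k‖²_{H₂}, and the stability estimates ‖x_f‖_{H₂} ≤ c₂‖f‖_{H₃}, ‖x_g‖_{H₂} ≤ c₁‖g‖_{H₁}, hence ‖x‖_{H₂} ≤ c₂‖f‖_{H₃} + c₁‖g‖_{H₁} + ‖k‖_{H₂}. -/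
open Submodule LinearPMap RealInnerProductSpace

noncomputable section

variable {H₁ H₂ H₃ : Type*}
  [NormedAddCommGroup H₁] [InnerProductSpace ℝ H₁] [CompleteSpace H₁]
  [NormedAddCommGroup H₂] [InnerProductSpace ℝ H₂] [CompleteSpace H₂]
  [NormedAddCommGroup H₃] [InnerProductSpace ℝ H₃] [CompleteSpace H₃]

/-- `x` solves the first order system `A₂ x = f`, `A₁† x = g`, `π x = k`, where `π` is the
orthogonal projection onto `K₂ = N(A₂) ∩ N(A₁†)` (so `π x = k` iff `k ∈ K₂` and
`x - k ⊥ K₂`). -/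
def IsFirstOrderSol (A₁ : H₁ →ₗ.[ℝ] H₂) (A₂ : H₂ →ₗ.[ℝ] H₃) (f : H₃) (g : H₁) (k x : H₂) :
    Prop :=
  ∃ (hx₂ : x ∈ A₂.domain) (hx₁ : x ∈ (A₁†).domain),
    A₂ ⟨x, hx₂⟩ = f ∧ A₁† ⟨x, hx₁⟩ = g ∧
      k ∈ pKer A₂ ⊓ pKer (A₁†) ∧ x - k ∈ (pKer A₂ ⊓ pKer (A₁†))ᗮ

section PartialMaps

variable {E F : Type*} [NormedAddCommGroup E] [InnerProductSpace ℝ E]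
  [NormedAddCommGroup F] [InnerProductSpace ℝ F]

lemma mem_pKer {A : E →ₗ.[ℝ] F} {x : E} :
    x ∈ pKer A ↔ ∃ h : x ∈ A.domain, A ⟨x, h⟩ = 0 := by
  constructor
  · rintro ⟨v, hv, rfl⟩
    exact ⟨v.2, hv⟩
  · rintro ⟨h, hx⟩
    exact ⟨⟨x, h⟩, hx, rfl⟩

lemma sub_mem_pKer {A : E →ₗ.[ℝ] F} {x y : E} (hx : x ∈ A.domain) (hy : y ∈ A.domain)
    (h : A ⟨x, hx⟩ = A ⟨y, hy⟩) : x - y ∈ pKer A :=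
  mem_pKer.2 ⟨A.domain.sub_mem hx hy,
    (A.map_sub ⟨x, hx⟩ ⟨y, hy⟩).trans (sub_eq_zero.2 h)⟩

/-- Adding a kernel element does not change the value of a partially defined operator. -/
lemma apply_eq_of_sub_mem_pKer {A : E →ₗ.[ℝ] F} {x y : E} (hx : x ∈ A.domain)
    (h : y - x ∈ pKer A) : ∃ hy : y ∈ A.domain, A ⟨y, hy⟩ = A ⟨x, hx⟩ := by
  obtain ⟨hd, h0⟩ := mem_pKer.1 h
  have hy : y ∈ A.domain := by simpa using A.domain.add_mem hd hx
  exact ⟨hy, sub_eq_zero.1 ((A.map_sub ⟨y, hy⟩ ⟨x, hx⟩).symm.trans h0)⟩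

/-- The kernel of a closed operator is closed. -/
lemma isClosed_pKer {A : E →ₗ.[ℝ] F} (hA : A.IsClosed) : IsClosed (pKer A : Set E) := by
  have h : (pKer A : Set E) = (fun x : E => (x, (0 : F))) ⁻¹' (A.graph : Set (E × F)) := by
    ext x
    simp only [SetLike.mem_coe, Set.mem_preimage, mem_pKer, LinearPMap.mem_graph_iff]
    constructor
    · rintro ⟨hx, h0⟩
      exact ⟨⟨x, hx⟩, rfl, h0⟩
    · rintro ⟨v, rfl, h0⟩
      exact ⟨v.2, h0⟩
  rw [h]
  exact IsClosed.preimage (by fun_prop) hA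

/-- `N(A†) = R(A)ᗮ`. -/
lemma pKer_adjoint [CompleteSpace E] {A : E →ₗ.[ℝ] F} (hA : Dense (A.domain : Set E)) :
    pKer (A†) = (pRan A)ᗮ := by
  ext y
  rw [mem_pKer, Submodule.mem_orthogonal']
  constructor
  · rintro ⟨hy, h0⟩ _ ⟨v, rfl⟩
    have := adjoint_isFormalAdjoint hA ⟨y, hy⟩ v
    rw [h0, inner_zero_left] at this
    exact this.symm
  · intro h
    have h' : ∀ v : A.domain, ⟪(0 : E), (v : E)⟫ = ⟪y, A v⟫ := fun v => by
      rw [inner_zero_left]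
      exact (h _ ⟨v, rfl⟩).symm
    have hy : y ∈ (A†).domain := mem_adjoint_domain_of_exists y ⟨0, h'⟩
    exact ⟨hy, adjoint_apply_eq hA ⟨y, hy⟩ h'⟩

/-- `R(A†) ⊆ N(A)ᗮ`. -/
lemma pRan_adjoint_le [CompleteSpace E] {A : E →ₗ.[ℝ] F} (hA : Dense (A.domain : Set E)) :
    pRan (A†) ≤ (pKer A)ᗮ := by
  rintro _ ⟨w, rfl⟩
  rw [Submodule.mem_orthogonal']
  intro u hu
  obtain ⟨hd, h0⟩ := mem_pKer.1 hu
  have := adjoint_isFormalAdjoint hA w ⟨u, hd⟩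
  rw [h0, inner_zero_right] at this
  exact this

/-- An operator satisfying a Poincaré estimate on `N(A)ᗮ` has `N(A)ᗮ ⊆ R(A†)`. -/
lemma orthogonal_pKer_le [CompleteSpace E] [CompleteSpace F] {A : E →ₗ.[ℝ] F}
    (hA : Dense (A.domain : Set E)) (hcl : A.IsClosed) {c : ℝ}
    (hc : ∀ v : A.domain, (v : E) ∈ (pKer A)ᗮ → ‖(v : E)‖ ≤ c * ‖A v‖) :
    (pKer A)ᗮ ≤ pRan (A†) := by
  intro y hy
  have : CompleteSpace (pKer A) := (isClosed_pKer hcl).completeSpace_coe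
  let φ : Module.Dual ℝ A.domain := (innerₛₗ ℝ y).comp A.domain.subtype
  have hφ : φ ∈ LinearMap.range A.toFun.dualMap := by
    rw [LinearMap.range_dualMap_eq_dualAnnihilator_ker, Submodule.mem_dualAnnihilator]
    intro v hv
    exact (Submodule.mem_orthogonal' _ _).1 hy v (mem_pKer.2 ⟨v.2, hv⟩)
  obtain ⟨ψ, hψ⟩ := hφ
  have hψv : ∀ v : A.domain, ψ (A v) = ⟪y, (v : E)⟫ := fun v => DFunLike.congr_fun hψ v
  have hbound : ∀ z : pRan A, ‖(ψ.domRestrict (pRan A)) z‖ ≤ ‖y‖ * c * ‖z‖ := by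
    rintro ⟨_, v, rfl⟩
    obtain ⟨hd, he⟩ := apply_eq_of_sub_mem_pKer (A := A) v.2
      (y := (v : E) - (pKer A).starProjection v) (by simp)
    have h1 := hc ⟨_, hd⟩ ((pKer A).sub_starProjection_mem_orthogonal (v : E))
    have h2 : ψ (A v) = ⟪y, (v : E) - (pKer A).starProjection v⟫ := by
      rw [← hψv ⟨_, hd⟩, he]
    rw [he] at h1
    calc ‖ψ (A v)‖ ≤ ‖y‖ * ‖(v : E) - (pKer A).starProjection v‖ := by
          rw [h2]; exact norm_inner_le_norm _ _
      _ ≤ ‖y‖ * (c * ‖A v‖) := by gcongr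
      _ = ‖y‖ * c * ‖A v‖ := by ring
  obtain ⟨g, hg, -⟩ := _root_.exists_extension_norm_eq (pRan A)
    ((ψ.domRestrict (pRan A)).mkContinuous _ hbound)
  have h' : ∀ v : A.domain, ⟪y, (v : E)⟫ = ⟪(InnerProductSpace.toDual ℝ F).symm g, A v⟫ := by
    intro v
    rw [InnerProductSpace.toDual_symm_apply, ← hψv v]
    exact (hg ⟨A v, v, rfl⟩).symm
  exact ⟨⟨_, mem_adjoint_domain_of_exists _ ⟨y, h'⟩⟩, adjoint_apply_eq hA _ h'⟩

end PartialMaps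

/-- Solution theory for the first order system `A₂ x = f`, `A₁† x = g`,
`π x = k`: solvability in `D₂ = D(A₂) ∩ D(A₁†)` is equivalent to `f ∈ R(A₂)`, `g ∈ R(A₁†)`,
`k ∈ K₂`; the solution is unique, given by `x = x_f + x_g + k` with
`x_f ∈ D(A₂) ∩ R(A₂†)`, `A₂ x_f = f` and `x_g ∈ D(A₁†) ∩ R(A₁)`, `A₁† x_g = g` (each unique),
`π_{R(A₂†)} x = x_f`, `π_{R(A₁)} x = x_g`, the norms decompose orthogonally, and the stability
estimates `‖x_f‖ ≤ c₂‖f‖`, `‖x_g‖ ≤ c₁‖g‖`, `‖x‖ ≤ c₂‖f‖ + c₁‖g‖ + ‖k‖` hold. -/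
theorem statement8 (A₁ : H₁ →ₗ.[ℝ] H₂) (A₂ : H₂ →ₗ.[ℝ] H₃)
    (hdense₁ : Dense (A₁.domain : Set H₁)) (hdense₂ : Dense (A₂.domain : Set H₂))
    (hclosed₁ : A₁.IsClosed) (hclosed₂ : A₂.IsClosed)
    (hcomplex : pRan A₁ ≤ pKer A₂)
    (hrange₁ : IsClosed (pRan A₁ : Set H₂)) (hrange₂ : IsClosed (pRan A₂ : Set H₃))
    (c₁ c₂ : ℝ) (hc₁pos : 0 < c₁) (hc₂pos : 0 < c₂)
    (hc₁ : ∀ v : A₁.domain, (v : H₁) ∈ (pKer A₁)ᗮ → ‖(v : H₁)‖ ≤ c₁ * ‖A₁ v‖)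
    (hc₁adj : ∀ w : (A₁†).domain, (w : H₂) ∈ (pKer (A₁†))ᗮ → ‖(w : H₂)‖ ≤ c₁ * ‖A₁† w‖)
    (hc₂ : ∀ v : A₂.domain, (v : H₂) ∈ (pKer A₂)ᗮ → ‖(v : H₂)‖ ≤ c₂ * ‖A₂ v‖)
    (hc₂adj : ∀ w : (A₂†).domain, (w : H₃) ∈ (pKer (A₂†))ᗮ → ‖(w : H₃)‖ ≤ c₂ * ‖A₂† w‖)
    (f : H₃) (g : H₁) (k : H₂) :
    -- solvability is equivalent to the compatibility conditions on the data
    ((∃ x : H₂, IsFirstOrderSol A₁ A₂ f g k x) ↔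
      (f ∈ pRan A₂ ∧ g ∈ pRan (A₁†) ∧ k ∈ pKer A₂ ⊓ pKer (A₁†)))
    -- uniqueness of the solution
    ∧ (∀ x x' : H₂, IsFirstOrderSol A₁ A₂ f g k x → IsFirstOrderSol A₁ A₂ f g k x' → x = x')
    -- explicit form and properties of the solution
    ∧ (f ∈ pRan A₂ → g ∈ pRan (A₁†) → k ∈ pKer A₂ ⊓ pKer (A₁†) →
        ∃ (xf xg : H₂) (hxf : xf ∈ A₂.domain) (hxg : xg ∈ (A₁†).domain),
          xf ∈ pRan (A₂†) ∧ A₂ ⟨xf, hxf⟩ = f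
          -- `x_f` is unique with these properties
          ∧ (∀ (x' : H₂) (hx' : x' ∈ A₂.domain),
              x' ∈ pRan (A₂†) → A₂ ⟨x', hx'⟩ = f → x' = xf)
          ∧ xg ∈ pRan A₁ ∧ A₁† ⟨xg, hxg⟩ = g
          -- `x_g` is unique with these properties
          ∧ (∀ (x' : H₂) (hx' : x' ∈ (A₁†).domain),
              x' ∈ pRan A₁ → A₁† ⟨x', hx'⟩ = g → x' = xg)
          -- `x = x_f + x_g + k` is the solution
          ∧ IsFirstOrderSol A₁ A₂ f g k (xf + xg + k)
          -- `π_{R(A₂†)} x = x_f` and `π_{R(A₁)} x = x_g`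
          ∧ (xf + xg + k) - xf ∈ (pRan (A₂†))ᗮ
          ∧ (xf + xg + k) - xg ∈ (pRan A₁)ᗮ
          -- the norm decomposes orthogonally
          ∧ ‖xf + xg + k‖ ^ 2 = ‖xf‖ ^ 2 + ‖xg‖ ^ 2 + ‖k‖ ^ 2
          -- stability estimates
          ∧ ‖xf‖ ≤ c₂ * ‖f‖ ∧ ‖xg‖ ≤ c₁ * ‖g‖
          ∧ ‖xf + xg + k‖ ≤ c₂ * ‖f‖ + c₁ * ‖g‖ + ‖k‖) := by
  have hK₁ : pKer (A₁†) = (pRan A₁)ᗮ := pKer_adjoint hdense₁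
  have hR₂ : pRan (A₂†) = (pKer A₂)ᗮ :=
    le_antisymm (pRan_adjoint_le hdense₂) (orthogonal_pKer_le hdense₂ hclosed₂ hc₂)
  have hcompl₁ : CompleteSpace (pRan A₁) := hrange₁.completeSpace_coe
  have hcompl₂ : CompleteSpace (pKer A₂) := (isClosed_pKer hclosed₂).completeSpace_coe
  have main : f ∈ pRan A₂ → g ∈ pRan (A₁†) → k ∈ pKer A₂ ⊓ pKer (A₁†) →
      ∃ (xf xg : H₂) (hxf : xf ∈ A₂.domain) (hxg : xg ∈ (A₁†).domain),
        xf ∈ pRan (A₂†) ∧ A₂ ⟨xf, hxf⟩ = f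
        ∧ (∀ (x' : H₂) (hx' : x' ∈ A₂.domain),
            x' ∈ pRan (A₂†) → A₂ ⟨x', hx'⟩ = f → x' = xf)
        ∧ xg ∈ pRan A₁ ∧ A₁† ⟨xg, hxg⟩ = g
        ∧ (∀ (x' : H₂) (hx' : x' ∈ (A₁†).domain),
            x' ∈ pRan A₁ → A₁† ⟨x', hx'⟩ = g → x' = xg)
        ∧ IsFirstOrderSol A₁ A₂ f g k (xf + xg + k)
        ∧ (xf + xg + k) - xf ∈ (pRan (A₂†))ᗮ
        ∧ (xf + xg + k) - xg ∈ (pRan A₁)ᗮ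
        ∧ ‖xf + xg + k‖ ^ 2 = ‖xf‖ ^ 2 + ‖xg‖ ^ 2 + ‖k‖ ^ 2
        ∧ ‖xf‖ ≤ c₂ * ‖f‖ ∧ ‖xg‖ ≤ c₁ * ‖g‖
        ∧ ‖xf + xg + k‖ ≤ c₂ * ‖f‖ + c₁ * ‖g‖ + ‖k‖ := by
    rintro ⟨v, rfl⟩ ⟨w, rfl⟩ hk
    obtain ⟨xf, hxf_orth, hxf_ker⟩ :
        ∃ xf, xf ∈ (pKer A₂)ᗮ ∧ xf - (v : H₂) ∈ pKer A₂ :=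
      ⟨(v : H₂) - (pKer A₂).starProjection v,
        (pKer A₂).sub_starProjection_mem_orthogonal (v : H₂),
        by simp⟩
    obtain ⟨xg, hxg_ran, hxg_ker⟩ :
        ∃ xg, xg ∈ pRan A₁ ∧ xg - (w : H₂) ∈ pKer (A₁†) := by
      refine ⟨(pRan A₁).starProjection w, (pRan A₁).starProjection_apply_mem (w : H₂), ?_⟩
      rw [hK₁, ← neg_sub]
      exact Submodule.neg_mem _ ((pRan A₁).sub_starProjection_mem_orthogonal (w : H₂))
    obtain ⟨hxf, hAf⟩ := apply_eq_of_sub_mem_pKer v.2 hxf_ker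
    obtain ⟨hxg, hAg⟩ := apply_eq_of_sub_mem_pKer w.2 hxg_ker
    have hxg_orth : xg ∈ (pKer (A₁†))ᗮ := by
      rw [hK₁]; exact Submodule.le_orthogonal_orthogonal _ hxg_ran
    have hxg_ker₂ : xg ∈ pKer A₂ := hcomplex hxg_ran
    have hxf_ker₁ : xf ∈ pKer (A₁†) := by
      rw [hK₁]; exact Submodule.orthogonal_le hcomplex hxf_orth
    have hsum₂ : xg + k ∈ pKer A₂ := add_mem hxg_ker₂ hk.1
    have hsum₁ : xf + k ∈ pKer (A₁†) := add_mem hxf_ker₁ hk.2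
    have e₂ : (xf + xg + k) - xf = xg + k := by abel
    have e₁ : (xf + xg + k) - xg = xf + k := by abel
    have hf_le : ‖xf‖ ≤ c₂ * ‖A₂ v‖ := hAf ▸ hc₂ ⟨xf, hxf⟩ hxf_orth
    have hg_le : ‖xg‖ ≤ c₁ * ‖A₁† w‖ := hAg ▸ hc₁adj ⟨xg, hxg⟩ hxg_orth
    refine ⟨xf, xg, hxf, hxg, hR₂ ▸ hxf_orth, hAf, ?_, hxg_ran, hAg, ?_, ?_, ?_, ?_, ?_,
      hf_le, hg_le, ?_⟩
    · intro x' hx' hran hAx'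
      have hd := sub_mem_pKer hx' hxf (hAx'.trans hAf.symm)
      have ho : x' - xf ∈ (pKer A₂)ᗮ := sub_mem (hR₂ ▸ hran) hxf_orth
      exact sub_eq_zero.1 (inner_self_eq_zero.1 ((Submodule.mem_orthogonal _ _).1 ho _ hd))
    · intro x' hx' hran hAx'
      have hd := sub_mem_pKer hx' hxg (hAx'.trans hAg.symm)
      rw [hK₁] at hd
      exact sub_eq_zero.1 (inner_self_eq_zero.1
        ((Submodule.mem_orthogonal _ _).1 hd _ (sub_mem hran hxg_ran)))
    · obtain ⟨hx₂, hA₂⟩ := apply_eq_of_sub_mem_pKer hxf (e₂ ▸ hsum₂)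
      obtain ⟨hx₁, hA₁⟩ := apply_eq_of_sub_mem_pKer hxg (e₁ ▸ hsum₁)
      refine ⟨hx₂, hx₁, hA₂.trans hAf, hA₁.trans hAg, hk, ?_⟩
      rw [add_sub_cancel_right]
      exact add_mem (Submodule.orthogonal_le inf_le_left hxf_orth)
        (Submodule.orthogonal_le inf_le_right hxg_orth)
    · rw [e₂, hR₂]
      exact Submodule.le_orthogonal_orthogonal _ hsum₂
    · rw [e₁, ← hK₁]
      exact hsum₁
    · have h₁ : ⟪xf, xg + k⟫ = 0 := (Submodule.mem_orthogonal' _ _).1 hxf_orth _ hsum₂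
      have h₂ : ⟪xg, k⟫ = 0 := (Submodule.mem_orthogonal' _ _).1 hxg_orth _ hk.2
      rw [add_assoc, norm_add_sq_real, norm_add_sq_real, h₁, h₂]
      ring
    · exact norm_add₃_le.trans (add_le_add (add_le_add hf_le hg_le) le_rfl)
  refine ⟨⟨?_, ?_⟩, ?_, main⟩
  · rintro ⟨x, hx₂, hx₁, hf, hg, hk, -⟩
    exact ⟨⟨⟨x, hx₂⟩, hf⟩, ⟨⟨x, hx₁⟩, hg⟩, hk⟩
  · rintro ⟨hf, hg, hk⟩
    obtain ⟨xf, xg, -, -, -, -, -, -, -, -, hsol, -⟩ := main hf hg hk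
    exact ⟨_, hsol⟩
  · rintro x x' ⟨hx₂, hx₁, hf, hg, -, hk⟩ ⟨hx₂', hx₁', hf', hg', -, hk'⟩
    have hker : x - x' ∈ pKer A₂ ⊓ pKer (A₁†) :=
      ⟨sub_mem_pKer hx₂ hx₂' (hf.trans hf'.symm), sub_mem_pKer hx₁ hx₁' (hg.trans hg'.symm)⟩
    have horth : x - x' ∈ (pKer A₂ ⊓ pKer (A₁†))ᗮ := by
      simpa using Submodule.sub_mem _ hk hk'
    exact sub_eq_zero.1 (inner_self_eq_zero.1 ((Submodule.mem_orthogonal _ _).1 horth _ hker))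
end
end
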